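/- arXiv:1506.06301 — 3 statements merged into one kernel-verified Lean document; each statement's English description precedes it below -/
import Mathlib

section
/- Let U ⊆ ℂ be open and let y₀ : U → ℂ be a solution of PVI(0,0,0,1/2) such that y₀ and its derivative y₀′ are ℂ-differentiable on U. Assume that for every x ∈ U: x ≠ 0, x ≠ 1, y₀(x) ∉ {0, 1, x}, and D(x) := x(x−1)·y₀′(x) − y₀(x)(y₀(x)−1) ≠ 0. Define y(x) := y₀(x) + y₀(x)(y₀(x)−1)(y₀(x)−x)/D(x), and assume y(x) ∉ {0, 1, x} for all x ∈ U. Then y is a solution on U of PVI(1/8, −1/8, 1/8, 3/8). (This is the Okamoto transformation taking solutions of the Painlevé VI equation with parameters (0,0,0,1/2) to solutions with parameters (1/8,−1/8,1/8,3/8).) -/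
/-- `y` is a solution of the Painlevé VI equation `PVI(α, β, γ, δ)` on the open set `U ⊆ ℂ`:
at every `x ∈ U` the second complex derivative of `y` exists and satisfies the Painlevé VI
equation with parameters `(α, β, γ, δ)`. -/
def IsPainleveVISolution (α β γ δ : ℂ) (U : Set ℂ) (y : ℂ → ℂ) : Prop :=
  ∀ x ∈ U, DifferentiableAt ℂ y x ∧ DifferentiableAt ℂ (deriv y) x ∧
    deriv (deriv y) x =
      (1 / 2) * (1 / y x + 1 / (y x - 1) + 1 / (y x - x)) * (deriv y x) ^ 2
        - (1 / x + 1 / (x - 1) + 1 / (y x - x)) * deriv y x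
        + (y x * (y x - 1) * (y x - x) / (x ^ 2 * (x - 1) ^ 2)) *
            (α + β * x / (y x) ^ 2 + γ * (x - 1) / (y x - 1) ^ 2
              + δ * x * (x - 1) / (y x - x) ^ 2)

/-- The conjugate momentum of a solution `q` of `PVI(0, 0, 0, 1/2)`. Along a solution, the pair
`(q, okamotoMomentum q)` satisfies a first-order Hamiltonian system, and the Okamoto transform of `q` is
`q + 1 / okamotoMomentum q`. -/
noncomputable def okamotoMomentum (q : ℂ → ℂ) (x : ℂ) : ℂ :=
  (x * (x - 1) * deriv q x - q x * (q x - 1)) / (q x * (q x - 1) * (q x - x))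

theorem deriv_eq_okamotoMomentum {q : ℂ → ℂ} {x : ℂ} (hx : x ≠ 0) (hx1 : x - 1 ≠ 0)
    (hq : q x ≠ 0) (hq1 : q x - 1 ≠ 0) (hqx : q x - x ≠ 0) :
    deriv q x = (q x * (q x - 1) * (q x - x) * okamotoMomentum q x + q x * (q x - 1)) /
      (x * (x - 1)) := by
  unfold okamotoMomentum
  field_simp
  ring

/-- The momentum equation of the Hamiltonian system, in terms of `q`. -/
theorem hasDerivAt_okamotoMomentum {U : Set ℂ} {q : ℂ → ℂ} {x : ℂ}
    (hsol : IsPainleveVISolution 0 0 0 (1 / 2) U q) (hxU : x ∈ U)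
    (hx : x ≠ 0) (hx1 : x - 1 ≠ 0)
    (hq : q x ≠ 0) (hq1 : q x - 1 ≠ 0) (hqx : q x - x ≠ 0) :
    HasDerivAt (okamotoMomentum q)
      (-((3 * q x ^ 2 - 2 * (1 + x) * q x + x) * okamotoMomentum q x ^ 2 / 2
        + (2 * q x - 1) * okamotoMomentum q x + 1 / 2) / (x * (x - 1))) x := by
  obtain ⟨hd, hdd, hode⟩ := hsol x hxU
  have hid := hasDerivAt_id' x
  have hf := hd.hasDerivAt
  have hff := hdd.hasDerivAt
  have hnum := ((hid.mul (hid.sub_const 1)).mul hff).sub (hf.mul (hf.sub_const 1))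
  have hden := (hf.mul (hf.sub_const 1)).mul (hf.sub hid)
  have key := hnum.div hden (mul_ne_zero (mul_ne_zero hq hq1) hqx)
  refine key.congr_deriv ?_
  simp only [Pi.mul_apply, Pi.sub_apply]
  rw [hode, deriv_eq_okamotoMomentum hx hx1 hq hq1 hqx]
  generalize okamotoMomentum q x = p
  generalize q x = a at *
  field_simp
  ring

/-- The Okamoto transformation takes solutions of `PVI(0,0,0,1/2)` to
solutions of `PVI(1/8, -1/8, 1/8, 3/8)`. -/
theorem okamoto_transformation (U : Set ℂ) (hU : IsOpen U) (y₀ : ℂ → ℂ)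
    (hy₀ : IsPainleveVISolution 0 0 0 (1 / 2) U y₀)
    (hreg : ∀ x ∈ U, x ≠ 0 ∧ x ≠ 1 ∧ y₀ x ≠ 0 ∧ y₀ x ≠ 1 ∧ y₀ x ≠ x ∧
      x * (x - 1) * deriv y₀ x - y₀ x * (y₀ x - 1) ≠ 0)
    (y : ℂ → ℂ)
    (hy : ∀ x : ℂ, y x = y₀ x + y₀ x * (y₀ x - 1) * (y₀ x - x) /
      (x * (x - 1) * deriv y₀ x - y₀ x * (y₀ x - 1)))
    (hyreg : ∀ x ∈ U, y x ≠ 0 ∧ y x ≠ 1 ∧ y x ≠ x) :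
    IsPainleveVISolution (1 / 8) (-(1 / 8)) (1 / 8) (3 / 8) U y := by
  set p := okamotoMomentum y₀ with hp
  have hyp : y = fun x => y₀ x + (p x)⁻¹ := by
    funext x
    rw [hy, hp, okamotoMomentum, inv_div]
  have hp0 : ∀ x ∈ U, p x ≠ 0 := fun x hxU => by
    obtain ⟨-, -, hq, hq1, hqx, hD⟩ := hreg x hxU
    exact div_ne_zero hD
      (mul_ne_zero (mul_ne_zero hq (sub_ne_zero.2 hq1)) (sub_ne_zero.2 hqx))
  have hp' : ∀ x ∈ U, HasDerivAt p ((-(3 * y x ^ 2 - 2 * (1 + x) * y x + x) * p x ^ 2 / 2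
      + (y x - x) * p x) / (x * (x - 1))) x := fun x hxU => by
    obtain ⟨hx, hx1, hq, hq1, hqx, -⟩ := hreg x hxU
    have hpx := hp0 x hxU
    rw [← sub_ne_zero] at hx1 hq1 hqx
    refine (hasDerivAt_okamotoMomentum hy₀ hxU hx hx1 hq hq1 hqx).congr_deriv ?_
    rw [← hp, hyp]
    field_simp
    ring
  have hy' : ∀ x ∈ U, HasDerivAt y ((y x * (y x - 1) * (y x - x) * p x
      - (3 * y x ^ 2 - 2 * (1 + x) * y x + x) / 2 + y x ^ 2 - y x) / (x * (x - 1))) x :=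
    fun x hxU => by
    obtain ⟨hx, hx1, hq, hq1, hqx, -⟩ := hreg x hxU
    have hpx := hp0 x hxU
    rw [← sub_ne_zero] at hx1 hq1 hqx
    have hsum := (hy₀ x hxU).1.hasDerivAt.add ((hp' x hxU).inv hpx)
    have hfun : y = y₀ + p⁻¹ := hyp
    rw [← hfun] at hsum
    refine hsum.congr_deriv ?_
    rw [deriv_eq_okamotoMomentum hx hx1 hq hq1 hqx, ← hp, hyp]
    field_simp
    ring
  intro x hxU
  obtain ⟨hx, hx1, -⟩ := hreg x hxU
  obtain ⟨hyx, hyx1, hyxx⟩ := hyreg x hxU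
  rw [← sub_ne_zero] at hx1 hyx1 hyxx
  have hid := hasDerivAt_id' x
  have h1 := hy' x hxU
  have h2 := hp' x hxU
  have hnum := (((((h1.mul (h1.sub_const 1)).mul (h1.sub hid)).mul h2).sub
    (((((h1.pow 2).const_mul 3).sub (((hid.const_add 1).const_mul 2).mul h1)).add
      hid).div_const 2)).add (h1.pow 2)).sub h1
  have hquot := hnum.div (hid.mul (hid.sub_const 1)) (mul_ne_zero hx hx1)
  have hderiv := hquot.congr_of_eventuallyEq (f₁ := deriv y) <| by
    filter_upwards [hU.mem_nhds hxU] with z hz using (hy' z hz).deriv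
  refine ⟨h1.differentiableAt, hderiv.differentiableAt, ?_⟩
  rw [hderiv.deriv, h1.deriv]
  simp only [Pi.mul_apply, Pi.sub_apply, Pi.add_apply, Pi.pow_apply]
  generalize p x = b
  generalize y x = a at *
  field_simp
  ring
end

section
/- Let U ⊆ ℂ be open and let y₀, O₀, O₁, O_x, p₀, p₁, p_x, p_Q : U → ℂ be ℂ-differentiable functions such that for every x ∈ U: (i) x ∉ {0,1} and y₀(x) ∉ {0,1,x}; (ii) p₀²·x = 4, p₁²·(1−x) = 4, p_x²·x(x−1) = 4, and p_Q²·y₀(y₀−1)(y₀−x) = 1; (iii) O₀ ≠ 0, O₁ ≠ 0, O_x ≠ 0; (iv) O₀/p₀ − O_x/p_x = p_Q·x·(y₀−1) and O₁/p₁ − O_x/p_x = p_Q·y₀·(x−1); (v) the derivatives satisfy y₀′ = −(1/4)·O_x·p_x/p_Q, O₀′ = (1/2)·(O_x·p_x/p₀)·(y₀−x)/(x·y₀), O₁′ = (1/2)·(O_x·p_x/p₁)·(y₀−x)/((x−1)(y₀−1)), p₀′ = −p₀/(2x), p₁′ = −p₁/(2(x−1)). Define β₁ := −(y₀/4)·O₀²,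 β₂ := ((1−y₀)/4)·O₁², β₃ := ((x−y₀)/4)·O_x², and a₁ := −(1/4)·y₀·O₀·p₀, a₂ := (1/4)·(1−y₀)·O₁·p₁, a₃ := (1/4)·(x−y₀)·O_x·p_x, and for i = 1,2,3 the 2×2 matrix A⁽ⁱ⁾ := [[−1/4 − βᵢ/2, aᵢ], [−(βᵢ+βᵢ²)/(4aᵢ), 1/4 + βᵢ/2]]. Then at every x ∈ U the entrywise derivatives of the matrix-valued functions A⁽ⁱ⁾ exist and satisfy the Schlesinger system: dA⁽¹⁾/dx = [A⁽³⁾, A⁽¹⁾]/x, dA⁽²⁾/dx = [A⁽³⁾, A⁽²⁾]/(x−1), and dA⁽³⁾/dx = −[A⁽³⁾, A⁽¹⁾]/x − [A⁽³⁾, A⁽²⁾]/(x−1). -/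
/-- The residue matrix of the paper's solution of the rank-two Schlesinger system,
built from the coefficient `β` and the `(1,2)`-entry `a`. -/
noncomputable def resMat (β a : ℂ) : Matrix (Fin 2) (Fin 2) ℂ :=
  !![-(1 : ℂ) / 4 - β / 2, a; -(β + β ^ 2) / (4 * a), 1 / 4 + β / 2]

/-- The matrix `A⁽¹⁾` built from `β₁ = −(y₀/4)·O₀²` and `a₁ = −(1/4)·y₀·O₀·p₀`. -/
noncomputable def Aone (y₀ O₀ p₀ : ℂ → ℂ) (t : ℂ) : Matrix (Fin 2) (Fin 2) ℂ :=
  resMat (-(y₀ t / 4) * (O₀ t) ^ 2) (-(1 / 4) * y₀ t * O₀ t * p₀ t)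

/-- The matrix `A⁽²⁾` built from `β₂ = ((1−y₀)/4)·O₁²` and `a₂ = (1/4)·(1−y₀)·O₁·p₁`. -/
noncomputable def Atwo (y₀ O₁ p₁ : ℂ → ℂ) (t : ℂ) : Matrix (Fin 2) (Fin 2) ℂ :=
  resMat ((1 - y₀ t) / 4 * (O₁ t) ^ 2) ((1 / 4) * (1 - y₀ t) * O₁ t * p₁ t)

/-- The matrix `A⁽³⁾` built from `β₃ = ((x−y₀)/4)·O_x²` and `a₃ = (1/4)·(x−y₀)·O_x·p_x`. -/
noncomputable def Athree (y₀ Ox px : ℂ → ℂ) (t : ℂ) : Matrix (Fin 2) (Fin 2) ℂ :=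
  resMat ((t - y₀ t) / 4 * (Ox t) ^ 2) ((1 / 4) * (t - y₀ t) * Ox t * px t)

/-- The matrix `resMat (a * w) a` with the removable division by `a` carried out. -/
noncomputable def resPoly (a w : ℂ) : Matrix (Fin 2) (Fin 2) ℂ :=
  !![-(1 : ℂ) / 4 - a * w / 2, a; -(w * (1 + a * w)) / 4, 1 / 4 + a * w / 2]

lemma resMat_eq_resPoly {β a w : ℂ} (ha : a ≠ 0) (hβ : β = a * w) :
    resMat β a = resPoly a w := by
  subst hβ
  have h : -(a * w + (a * w) ^ 2) / (4 * a) = -(w * (1 + a * w)) / 4 := by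
    field_simp
  simp only [resMat, resPoly, h]

/-- In the coordinates `(a, w)`, the equation `A' = s [B, A]` is a pair of scalar equations. -/
lemma hasDerivAt_resPoly {a w : ℂ → ℂ} {b v s x : ℂ}
    (ha : HasDerivAt a (s * ((b - a x) / 2 - a x * b * (v - w x))) x)
    (hw : HasDerivAt w (s * ((w x - v) / 2 - b * (w x - v) ^ 2 / 2)) x) (i j : Fin 2) :
    HasDerivAt (fun t => resPoly (a t) (w t) i j)
      ((s • (resPoly b v * resPoly (a x) (w x) - resPoly (a x) (w x) * resPoly b v)) i j) x := by
  have haw := ha.mul hw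
  fin_cases i <;> fin_cases j <;>
    simp only [resPoly, Fin.zero_eta, Fin.mk_one, Matrix.smul_apply, Matrix.sub_apply,
      Matrix.mul_apply, Fin.sum_univ_two, Matrix.of_apply, Matrix.cons_val', Matrix.cons_val_zero,
      Matrix.cons_val_one, Matrix.cons_val_fin_one, smul_eq_mul]
  · refine ((haw.div_const 2).const_sub (-(1 : ℂ) / 4)).congr_deriv ?_
    ring
  · refine ha.congr_deriv ?_
    ring
  · refine ((hw.mul (haw.const_add 1)).neg.div_const 4).congr_deriv ?_
    simp only [Pi.mul_apply]
    ring
  · refine ((haw.div_const 2).const_add ((1 : ℂ) / 4)).congr_deriv ?_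
    ring

/-- The residue matrices sum to a constant diagonal matrix. -/
lemma resPoly_sum {x y q w : ℂ} (hx : x ≠ 0) (hx1 : x - 1 ≠ 0)
    (hq : q ^ 2 * (y * (y - 1) * (y - x)) = 1) :
    resPoly (-(y * (w + q * x * (y - 1))) / x) (w + q * x * (y - 1))
      + resPoly ((y - 1) * (w + q * y * (x - 1)) / (x - 1)) (w + q * y * (x - 1))
      + resPoly ((x - y) * w / (x * (x - 1))) w
      = !![-(1 : ℂ) / 4, 0; 0, 1 / 4] := by
  ext i j
  fin_cases i <;> fin_cases j <;> simp [resPoly] <;> field_simp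
  · linear_combination (4 * x * (x - 1)) * hq
  · ring
  · linear_combination (x * (x - 1) * (3 * w + q * (2 * x * y - x - y))) * hq
  · linear_combination (-4 * x * (x - 1)) * hq

/-- The paper's solution of the four-point Schlesinger system associated to the family of
elliptic curves `v² = u(u−1)(u−x)`: the matrices built from the data
`y₀, Ω(P₀), Ω(P₁), Ω(P_x), φ(P₀), φ(P₁), φ(P_x), φ(Q₀)` satisfy the Schlesinger equations. -/
theorem elliptic_schlesinger (U : Set ℂ) (hU : IsOpen U)
    (y₀ O₀ O₁ Ox p₀ p₁ px pQ : ℂ → ℂ)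
    (hdiff : DifferentiableOn ℂ y₀ U ∧ DifferentiableOn ℂ O₀ U ∧ DifferentiableOn ℂ O₁ U ∧
      DifferentiableOn ℂ Ox U ∧ DifferentiableOn ℂ p₀ U ∧ DifferentiableOn ℂ p₁ U ∧
      DifferentiableOn ℂ px U ∧ DifferentiableOn ℂ pQ U)
    (hreg : ∀ x ∈ U, x ≠ 0 ∧ x ≠ 1 ∧ y₀ x ≠ 0 ∧ y₀ x ≠ 1 ∧ y₀ x ≠ x)
    (hphi : ∀ x ∈ U, (p₀ x) ^ 2 * x = 4 ∧ (p₁ x) ^ 2 * (1 - x) = 4 ∧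
      (px x) ^ 2 * (x * (x - 1)) = 4 ∧
      (pQ x) ^ 2 * (y₀ x * (y₀ x - 1) * (y₀ x - x)) = 1)
    (hO : ∀ x ∈ U, O₀ x ≠ 0 ∧ O₁ x ≠ 0 ∧ Ox x ≠ 0)
    (hrel : ∀ x ∈ U, O₀ x / p₀ x - Ox x / px x = pQ x * x * (y₀ x - 1) ∧
      O₁ x / p₁ x - Ox x / px x = pQ x * y₀ x * (x - 1))
    (hder : ∀ x ∈ U,
      HasDerivAt y₀ (-(1 / 4) * Ox x * px x / pQ x) x ∧
      HasDerivAt O₀ ((1 / 2) * (Ox x * px x / p₀ x) * ((y₀ x - x) / (x * y₀ x))) x ∧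
      HasDerivAt O₁ ((1 / 2) * (Ox x * px x / p₁ x) *
        ((y₀ x - x) / ((x - 1) * (y₀ x - 1)))) x ∧
      HasDerivAt p₀ (-(p₀ x) / (2 * x)) x ∧
      HasDerivAt p₁ (-(p₁ x) / (2 * (x - 1))) x) :
    ∀ x ∈ U,
      (∀ i j : Fin 2, HasDerivAt (fun t => Aone y₀ O₀ p₀ t i j)
        ((x⁻¹ • (Athree y₀ Ox px x * Aone y₀ O₀ p₀ x
          - Aone y₀ O₀ p₀ x * Athree y₀ Ox px x)) i j) x) ∧
      (∀ i j : Fin 2, HasDerivAt (fun t => Atwo y₀ O₁ p₁ t i j)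
        (((x - 1)⁻¹ • (Athree y₀ Ox px x * Atwo y₀ O₁ p₁ x
          - Atwo y₀ O₁ p₁ x * Athree y₀ Ox px x)) i j) x) ∧
      (∀ i j : Fin 2, HasDerivAt (fun t => Athree y₀ Ox px t i j)
        ((-(x⁻¹ • (Athree y₀ Ox px x * Aone y₀ O₀ p₀ x
            - Aone y₀ O₀ p₀ x * Athree y₀ Ox px x))
          - (x - 1)⁻¹ • (Athree y₀ Ox px x * Atwo y₀ O₁ p₁ x
            - Atwo y₀ O₁ p₁ x * Athree y₀ Ox px x)) i j) x) := by
  intro x hxU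
  have key : ∀ t ∈ U, Aone y₀ O₀ p₀ t
        = resPoly (-(1 / 4) * y₀ t * O₀ t * p₀ t) (O₀ t / p₀ t) ∧
      Atwo y₀ O₁ p₁ t = resPoly ((1 / 4) * (1 - y₀ t) * O₁ t * p₁ t) (O₁ t / p₁ t) ∧
      Athree y₀ Ox px t = resPoly ((1 / 4) * (t - y₀ t) * Ox t * px t) (Ox t / px t) ∧
      -(1 / 4) * y₀ t * O₀ t * p₀ t = -(y₀ t * (O₀ t / p₀ t)) / t ∧
      (1 / 4) * (1 - y₀ t) * O₁ t * p₁ t = (y₀ t - 1) * (O₁ t / p₁ t) / (t - 1) ∧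
      (1 / 4) * (t - y₀ t) * Ox t * px t = (t - y₀ t) * (Ox t / px t) / (t * (t - 1)) := by
    intro t ht
    obtain ⟨h0, h1, hy0, hy1, hyx⟩ := hreg t ht
    obtain ⟨e0, e1, ex, -⟩ := hphi t ht
    obtain ⟨hO0, hO1, hOx⟩ := hO t ht
    have n1 : t - 1 ≠ 0 := sub_ne_zero.2 h1
    have m1 : 1 - y₀ t ≠ 0 := sub_ne_zero.2 hy1.symm
    have mx : t - y₀ t ≠ 0 := sub_ne_zero.2 hyx.symm
    have k0 : p₀ t ≠ 0 := by rintro h; simp [h] at e0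
    have k1 : p₁ t ≠ 0 := by rintro h; simp [h] at e1
    have kx : px t ≠ 0 := by rintro h; simp [h] at ex
    refine ⟨resMat_eq_resPoly (by simp_all) (by field_simp),
      resMat_eq_resPoly (by simp_all) (by field_simp),
      resMat_eq_resPoly (by simp_all) (by field_simp), ?_, ?_, ?_⟩
    · field_simp
      linear_combination (-1 : ℂ) * e0
    · field_simp
      linear_combination (y₀ t - 1) * e1
    · field_simp
      linear_combination ex
  have hnhds : ∀ᶠ t in nhds x, t ∈ U := hU.mem_nhds hxU
  obtain ⟨h0, h1, hy0, hy1, hyx⟩ := hreg x hxU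
  obtain ⟨e0, e1, ex, eQ⟩ := hphi x hxU
  obtain ⟨r0, r1⟩ := hrel x hxU
  obtain ⟨dy, dO0, dO1, dp0, dp1⟩ := hder x hxU
  obtain ⟨E1, E2, E3, f0, f1, fx⟩ := key x hxU
  have n1 : x - 1 ≠ 0 := sub_ne_zero.2 h1
  have m1 : y₀ x - 1 ≠ 0 := sub_ne_zero.2 hy1
  have k0 : p₀ x ≠ 0 := by rintro h; simp [h] at e0
  have k1 : p₁ x ≠ 0 := by rintro h; simp [h] at e1
  have kx : px x ≠ 0 := by rintro h; simp [h] at ex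
  have kQ : pQ x ≠ 0 := by rintro h; simp [h] at eQ
  have s0 : O₀ x / p₀ x = Ox x / px x + pQ x * x * (y₀ x - 1) := by linear_combination r0
  have s1 : O₁ x / p₁ x = Ox x / px x + pQ x * y₀ x * (x - 1) := by linear_combination r1
  have gx : Ox x * px x = 4 * (Ox x / px x) / (x * (x - 1)) := by
    field_simp
    linear_combination Ox x * ex
  have dy' : HasDerivAt y₀ (-(Ox x / px x) * pQ x * (y₀ x * (y₀ x - 1) * (y₀ x - x))
      / (x * (x - 1))) x := by
    refine dy.congr_deriv ?_
    rw [mul_assoc, gx]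
    generalize Ox x / px x = w
    field_simp
    linear_combination w * eQ
  have dw0 : HasDerivAt (fun t => O₀ t / p₀ t) (Ox x / px x * (y₀ x - x)
      / (2 * x * (x - 1) * y₀ x) + (O₀ x / p₀ x) / (2 * x)) x := by
    refine (dO0.div dp0 k0).congr_deriv ?_
    rw [gx]
    generalize Ox x / px x = w
    field_simp
    linear_combination (-w * (y₀ x - x)) * e0
  have dw1 : HasDerivAt (fun t => O₁ t / p₁ t) (-(Ox x / px x) * (y₀ x - x)
      / (2 * x * (x - 1) * (y₀ x - 1)) + (O₁ x / p₁ x) / (2 * (x - 1))) x := by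
    refine (dO1.div dp1 k1).congr_deriv ?_
    rw [gx]
    generalize Ox x / px x = w
    field_simp
    linear_combination (-w * (y₀ x - x)) * e1
  have D1 : ∀ i j : Fin 2, HasDerivAt (fun t => Aone y₀ O₀ p₀ t i j)
      ((x⁻¹ • (Athree y₀ Ox px x * Aone y₀ O₀ p₀ x
        - Aone y₀ O₀ p₀ x * Athree y₀ Ox px x)) i j) x := by
    intro i j
    rw [E1, E3, f0, fx]
    refine (hasDerivAt_resPoly (a := fun t => -(y₀ t * (O₀ t / p₀ t)) / t)
      (w := fun t => O₀ t / p₀ t) ?_ ?_ i j).congr_of_eventuallyEq ?_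
    · refine ((dy'.mul dw0).neg.div (hasDerivAt_id x) h0).congr_deriv ?_
      simp only [s0, Pi.mul_apply, Pi.neg_apply, id]
      generalize Ox x / px x = w
      field_simp
      ring
    · refine dw0.congr_deriv ?_
      simp only [s0]
      generalize Ox x / px x = w
      field_simp
      linear_combination (-x ^ 2 * w * (y₀ x - 1)) * eQ
    · filter_upwards [hnhds] with t ht
      rw [(key t ht).1, (key t ht).2.2.2.1]
  have D2 : ∀ i j : Fin 2, HasDerivAt (fun t => Atwo y₀ O₁ p₁ t i j)
      (((x - 1)⁻¹ • (Athree y₀ Ox px x * Atwo y₀ O₁ p₁ x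
        - Atwo y₀ O₁ p₁ x * Athree y₀ Ox px x)) i j) x := by
    intro i j
    rw [E2, E3, f1, fx]
    refine (hasDerivAt_resPoly (a := fun t => (y₀ t - 1) * (O₁ t / p₁ t) / (t - 1))
      (w := fun t => O₁ t / p₁ t) ?_ ?_ i j).congr_of_eventuallyEq ?_
    · refine (((dy'.sub_const 1).mul dw1).div ((hasDerivAt_id x).sub_const 1) n1).congr_deriv ?_
      simp only [s1, Pi.mul_apply, id]
      generalize Ox x / px x = w
      field_simp
      ring
    · refine dw1.congr_deriv ?_
      simp only [s1]
      generalize Ox x / px x = w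
      field_simp
      linear_combination (-w * y₀ x * (x - 1) ^ 2) * eQ
    · filter_upwards [hnhds] with t ht
      rw [(key t ht).2.1, (key t ht).2.2.2.2.1]
  refine ⟨D1, D2, fun i j => ?_⟩
  refine (((D1 i j).add (D2 i j)).const_sub
    ((!![-(1 : ℂ) / 4, 0; 0, 1 / 4] : Matrix (Fin 2) (Fin 2) ℂ) i j)).congr_deriv ?_
    |>.congr_of_eventuallyEq ?_
  · simp only [Matrix.sub_apply, Matrix.neg_apply]
    ring
  · filter_upwards [hnhds] with t ht
    obtain ⟨g0, g1, -⟩ := hreg t ht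
    obtain ⟨T1, T2, T3, u0, u1, ux⟩ := key t ht
    have hsum := resPoly_sum (w := Ox t / px t) g0 (sub_ne_zero.2 g1) (hphi t ht).2.2.2
    have v0 : O₀ t / p₀ t = Ox t / px t + pQ t * t * (y₀ t - 1) := by
      linear_combination (hrel t ht).1
    have v1 : O₁ t / p₁ t = Ox t / px t + pQ t * y₀ t * (t - 1) := by
      linear_combination (hrel t ht).2
    rw [← v0, ← v1, ← u0, ← u1, ← ux, ← T1, ← T2, ← T3] at hsum
    simp only [← hsum, Matrix.add_apply, Pi.add_apply]
    ring
end

section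
/- In the setting of the hyperelliptic residue data, assume additionally A12_n ≠ 0 for every n ∈ {1,…,N}. Then Σ_{n=1}^N (β_n + β_n²)/A12_n = 0; equivalently, the (2,1)-entries A21_n := −(β_n + β_n²)/(4·A12_n) of the residue matrices satisfy Σ_{n=1}^N A21_n = 0. -/
open Finset

/-- The residue `A12^{(n)}` of the function `A₁₂(u)` associated with the differential `Ω`
on the hyperelliptic curve `v² = ∏_{m=1}^N (u − u_m)`, as an explicit rational expression:
`A12_n = [Σ_j (1/(u_n−q_j) + α_j)·∏_{β≠j}(u_n−q_β)/(w_j·∏_{β≠j}(q_j−q_β))]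
          · ∏_β (u_n−q_β) / ∏_{m≠n}(u_n−u_m)`. -/
noncomputable def A12res {g N : ℕ} (u : Fin N → ℂ) (q w a : Fin g → ℂ) (n : Fin N) : ℂ :=
  (∑ j, (1 / (u n - q j) + a j) * (∏ β ∈ univ.erase j, (u n - q β)) /
      (w j * ∏ β ∈ univ.erase j, (q j - q β))) *
    (∏ β, (u n - q β)) / ∏ m ∈ univ.erase n, (u n - u m)

/-- The value `Ω_∞ = Ω(P_∞) = −2·Σ_j α_j/(w_j·∏_{β≠j}(q_j−q_β))`. -/
noncomputable def OmegaInfty {g : ℕ} (q w a : Fin g → ℂ) : ℂ :=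
  -2 * ∑ j, a j / (w j * ∏ β ∈ univ.erase j, (q j - q β))

/-- The coefficient
`β_n = A12_n·(Σ_j 1/(w_j·(u_n−q_j)·∏_{β≠j}(q_j−q_β)) − Ω_∞/2)`. -/
noncomputable def betaCoef {g N : ℕ} (u : Fin N → ℂ) (q w a : Fin g → ℂ) (n : Fin N) : ℂ :=
  A12res u q w a n *
    ((∑ j, 1 / (w j * (u n - q j) * ∏ β ∈ univ.erase j, (q j - q β))) -
      OmegaInfty q w a / 2)

open Polynomial in
/-- Partial fractions of `f / nodal s v`, cleared of the denominator `nodal s v`. -/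
theorem eval_eq_eval_nodal_mul_sum {ι F : Type*} [DecidableEq ι] [Field F] {s : Finset ι}
    {v : ι → F} (hv : Set.InjOn v s) {f : F[X]} (hf : f.degree < #s) {x : F}
    (hx : ∀ i ∈ s, x ≠ v i) :
    f.eval x = (Lagrange.nodal s v).eval x *
      ∑ i ∈ s, Lagrange.nodalWeight s v i * (x - v i)⁻¹ * f.eval (v i) := by
  conv_lhs => rw [Lagrange.eq_interpolate hv hf]
  exact Lagrange.eval_interpolate_not_at_node _ hx

open Polynomial in
/-- The logarithmic derivative of a nodal polynomial. -/
theorem eval_derivative_nodal_eq_mul_sum {ι F : Type*} [DecidableEq ι] [Field F] {s : Finset ι}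
    {v : ι → F} {x : F} (hx : ∀ i ∈ s, x ≠ v i) :
    (derivative (Lagrange.nodal s v)).eval x =
      (Lagrange.nodal s v).eval x * ∑ i ∈ s, (x - v i)⁻¹ := by
  rw [Lagrange.derivative_nodal, eval_finsetSum, mul_sum]
  refine sum_congr rfl fun i hi => ?_
  have h : x - v i ≠ 0 := sub_ne_zero.mpr (hx i hi)
  rw [Lagrange.nodal_eq_mul_nodal_erase hi, eval_mul, eval_sub, eval_X, eval_C]
  field_simp

open Polynomial in
/-- The derivative of the partial fraction decomposition of `f / nodal s v`. -/
theorem eval_derivative_eq_eval_nodal_mul {ι 𝕜 : Type*} [DecidableEq ι]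
    [NontriviallyNormedField 𝕜] {s : Finset ι} {v : ι → 𝕜} (hv : Set.InjOn v s) {f : 𝕜[X]}
    (hf : f.degree < #s) {x : 𝕜} (hx : ∀ i ∈ s, x ≠ v i) :
    (derivative f).eval x = (Lagrange.nodal s v).eval x *
      ((∑ i ∈ s, (x - v i)⁻¹) *
          (∑ i ∈ s, Lagrange.nodalWeight s v i * (x - v i)⁻¹ * f.eval (v i)) -
        ∑ i ∈ s, Lagrange.nodalWeight s v i * (x - v i)⁻¹ ^ 2 * f.eval (v i)) := by
  have hsum : HasDerivAt
      (fun y => ∑ i ∈ s, Lagrange.nodalWeight s v i * (y - v i)⁻¹ * f.eval (v i))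
      (∑ i ∈ s, Lagrange.nodalWeight s v i * (-1 / (x - v i) ^ 2) * f.eval (v i)) x := by
    refine HasDerivAt.fun_sum fun i hi => ?_
    exact ((((hasDerivAt_id x).sub_const (v i)).fun_inv
      (sub_ne_zero.mpr (hx i hi))).const_mul _).mul_const _
  have hprod := ((Lagrange.nodal s v).hasDerivAt x).fun_mul hsum
  have hnear : ∀ᶠ y in nhds x, ∀ i ∈ s, y ≠ v i :=
    (Filter.eventually_all_finset s).mpr fun i hi => eventually_ne_nhds (hx i hi)
  have heq := hprod.congr_of_eventuallyEq
    (hnear.mono fun y hy => eval_eq_eval_nodal_mul_sum hv hf hy)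
  rw [(f.hasDerivAt x).unique heq, eval_derivative_nodal_eq_mul_sum hx]
  have hneg : ∑ i ∈ s, Lagrange.nodalWeight s v i * (-1 / (x - v i) ^ 2) * f.eval (v i) =
      -∑ i ∈ s, Lagrange.nodalWeight s v i * (x - v i)⁻¹ ^ 2 * f.eval (v i) := by
    rw [← sum_neg_distrib]
    refine sum_congr rfl fun i _ => ?_
    rw [inv_pow]
    ring
  rw [hneg]
  ring

open Polynomial in
/-- The polynomial `∏ (X - q_j) * (∑ c_j / (X - q_j) + d)`. -/
noncomputable def partialFractionNumerator {g : ℕ} (q c : Fin g → ℂ) (d : ℂ) : ℂ[X] :=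
  (∑ j, C (c j) * Lagrange.nodal (univ.erase j) q) + C d * Lagrange.nodal univ q

namespace partialFractionNumerator

open Polynomial

variable {g : ℕ} (q c : Fin g → ℂ) (d : ℂ)

theorem degree_sum_lt :
    (∑ j, C (c j) * Lagrange.nodal (univ.erase j) q).degree < (g : WithBot ℕ) := by
  refine (degree_sum_le _ _).trans_lt ((Finset.sup_lt_iff (WithBot.bot_lt_coe g)).mpr ?_)
  intro j _
  rw [C_mul']
  refine (degree_smul_le _ _).trans_lt ?_
  rw [Lagrange.degree_nodal, card_erase_of_mem (mem_univ j), card_univ, Fintype.card_fin]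
  exact WithBot.coe_lt_coe.mpr (Nat.sub_lt j.pos one_pos)

theorem natDegree_le : (partialFractionNumerator q c d).natDegree ≤ g := by
  refine natDegree_le_of_degree_le ((degree_add_le _ _).trans (max_le (degree_sum_lt q c).le ?_))
  rw [C_mul']
  refine (degree_smul_le _ _).trans ?_
  simp [Lagrange.degree_nodal]

theorem coeff_top : (partialFractionNumerator q c d).coeff g = d := by
  have h : (Lagrange.nodal univ q).coeff g = 1 := by
    have := (Lagrange.nodal_monic (s := univ) (v := q)).coeff_natDegree
    rwa [Lagrange.natDegree_nodal, card_univ, Fintype.card_fin] at this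
  rw [partialFractionNumerator, coeff_add, coeff_eq_zero_of_degree_lt (degree_sum_lt q c),
    coeff_C_mul, h, zero_add, mul_one]

theorem eval_of_ne {x : ℂ} (hx : ∀ j, x ≠ q j) :
    (partialFractionNumerator q c d).eval x =
      (∏ j, (x - q j)) * (∑ j, c j * (x - q j)⁻¹ + d) := by
  simp only [partialFractionNumerator, eval_add, eval_finsetSum, eval_mul, eval_C,
    Lagrange.eval_nodal, mul_add, mul_sum]
  rw [mul_comm d]
  congr 1
  refine sum_congr rfl fun j _ => ?_
  have h : x - q j ≠ 0 := sub_ne_zero.mpr (hx j)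
  rw [← mul_prod_erase univ (fun i => x - q i) (mem_univ j)]
  field_simp

theorem eval_node (k : Fin g) :
    (partialFractionNumerator q c d).eval (q k) = c k * ∏ i ∈ univ.erase k, (q k - q i) := by
  simp only [partialFractionNumerator, eval_add, eval_finsetSum, eval_mul, eval_C]
  rw [Lagrange.eval_nodal_at_node (mem_univ k), mul_zero, add_zero,
    sum_eq_single_of_mem k (mem_univ k), Lagrange.eval_nodal]
  intro j _ hj
  rw [Lagrange.eval_nodal_at_node (mem_erase.mpr ⟨hj.symm, mem_univ k⟩), mul_zero]

theorem sum_eval_derivative_div (hq : Function.Injective q) :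
    ∑ k, (derivative (partialFractionNumerator q c d)).eval (q k) /
      ∏ i ∈ univ.erase k, (q k - q i) = g * d := by
  rcases Nat.eq_zero_or_pos g with rfl | hg
  · simp
  have hdeg : (derivative (partialFractionNumerator q c d)).degree < #(univ : Finset (Fin g)) := by
    rw [card_univ, Fintype.card_fin]
    refine lt_of_le_of_lt degree_le_natDegree ?_
    have h1 := natDegree_derivative_le (partialFractionNumerator q c d)
    have h2 := natDegree_le q c d
    exact_mod_cast (by omega : (derivative (partialFractionNumerator q c d)).natDegree < g)
  rw [← Lagrange.coeff_eq_sum hq.injOn hdeg, card_univ, Fintype.card_fin, coeff_derivative,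
    Nat.sub_add_cancel hg, coeff_top, Nat.cast_sub hg]
  push_cast
  ring

end partialFractionNumerator

theorem A12res_eq {g N : ℕ} (u : Fin N → ℂ) (q w a : Fin g → ℂ)
    (hqu : ∀ (j : Fin g) (n : Fin N), q j ≠ u n) (n : Fin N) :
    A12res u q w a n = Lagrange.nodalWeight univ u n * (∏ j, (u n - q j)) ^ 2 *
      ∑ k, (w k * ∏ i ∈ univ.erase k, (q k - q i))⁻¹ *
        ((q k - u n)⁻¹ ^ 2 - a k * (q k - u n)⁻¹) := by
  rw [A12res, Lagrange.nodalWeight, prod_inv_distrib, div_eq_mul_inv, pow_two]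
  have h : ∑ j, (1 / (u n - q j) + a j) * (∏ β ∈ univ.erase j, (u n - q β)) /
      (w j * ∏ β ∈ univ.erase j, (q j - q β)) = (∏ j, (u n - q j)) *
      ∑ k, (w k * ∏ i ∈ univ.erase k, (q k - q i))⁻¹ *
        ((q k - u n)⁻¹ ^ 2 - a k * (q k - u n)⁻¹) := by
    rw [mul_sum]
    refine sum_congr rfl fun k _ => ?_
    have h1 : u n - q k ≠ 0 := sub_ne_zero.mpr (hqu k n).symm
    rw [← mul_prod_erase univ (fun i => u n - q i) (mem_univ k), ← neg_sub (u n) (q k), inv_neg,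
      div_eq_mul_inv _ (w k * _)]
    field_simp
    ring
  rw [h]
  ring

theorem betaCoef_eq {g N : ℕ} (u : Fin N → ℂ) (q w a : Fin g → ℂ) (n : Fin N) :
    betaCoef u q w a n = A12res u q w a n *
      (∑ j, (w j * ∏ i ∈ univ.erase j, (q j - q i))⁻¹ * (u n - q j)⁻¹ +
        ∑ j, a j * (w j * ∏ i ∈ univ.erase j, (q j - q i))⁻¹) := by
  have h : ∑ j, 1 / (w j * (u n - q j) * ∏ β ∈ univ.erase j, (q j - q β)) =
      ∑ j, (w j * ∏ i ∈ univ.erase j, (q j - q i))⁻¹ * (u n - q j)⁻¹ := by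
    refine sum_congr rfl fun j _ => ?_
    rw [one_div, ← mul_inv, mul_right_comm]
  rw [betaCoef, OmegaInfty, h]
  simp only [div_eq_mul_inv (a _)]
  ring

/-- The sum of the residues `A12_n * S(u_n)²`, where `S(x) = ∑ c_j / (x - q_j) + d`. -/
theorem sum_A12res_mul_sq {g N : ℕ} (hN : N = 2 * g + 1)
    (u : Fin N → ℂ) (q w a : Fin g → ℂ) (hu : Function.Injective u) (hq : Function.Injective q)
    (hqu : ∀ (j : Fin g) (n : Fin N), q j ≠ u n)
    (hw : ∀ j, (w j) ^ 2 * ∏ m, (q j - u m) = 1) (c : Fin g → ℂ)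
    (hc : ∀ j, c j = (w j * ∏ i ∈ univ.erase j, (q j - q i))⁻¹) :
    ∑ n, A12res u q w a n * (∑ j, c j * (u n - q j)⁻¹ + ∑ j, a j * c j) ^ 2 =
      -∑ n, (∑ j, c j * (u n - q j)⁻¹ + ∑ j, a j * c j) := by
  set d := ∑ j, a j * c j with hd
  set R := partialFractionNumerator q c d with hR
  have hdeg : (R ^ 2).degree < #(univ : Finset (Fin N)) := by
    rw [card_univ, Fintype.card_fin]
    refine lt_of_le_of_lt Polynomial.degree_le_natDegree ?_
    have h1 := Polynomial.natDegree_pow_le (p := R) (n := 2)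
    have h2 := partialFractionNumerator.natDegree_le q c d
    exact_mod_cast (by rw [← hR] at h2; omega : (R ^ 2).natDegree < N)
  have hterm : ∀ n, A12res u q w a n * (∑ j, c j * (u n - q j)⁻¹ + d) ^ 2 =
      ∑ k, c k * (Lagrange.nodalWeight univ u n * (q k - u n)⁻¹ ^ 2 * (R ^ 2).eval (u n) -
        a k * (Lagrange.nodalWeight univ u n * (q k - u n)⁻¹ * (R ^ 2).eval (u n))) := by
    intro n
    rw [A12res_eq u q w a hqu n, Polynomial.eval_pow, hR,
      partialFractionNumerator.eval_of_ne q c d fun j => (hqu j n).symm, mul_right_comm, mul_sum]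
    refine sum_congr rfl fun k _ => ?_
    rw [← hc k]
    ring
  have hres : ∀ k, c k * (∑ n, Lagrange.nodalWeight univ u n * (q k - u n)⁻¹ ^ 2 *
        (R ^ 2).eval (u n) - a k * ∑ n, Lagrange.nodalWeight univ u n * (q k - u n)⁻¹ *
          (R ^ 2).eval (u n)) =
      c k * ∑ n, (q k - u n)⁻¹ - 2 * ((Polynomial.derivative R).eval (q k) /
        ∏ i ∈ univ.erase k, (q k - q i)) - a k * c k := by
    intro k
    have hwk : w k ≠ 0 := fun h => by simpa [h] using hw k
    have hprod : ∏ i ∈ univ.erase k, (q k - q i) ≠ 0 :=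
      prod_ne_zero_iff.mpr fun i hi => sub_ne_zero.mpr (hq.ne (ne_of_mem_erase hi).symm)
    have hRk : w k * R.eval (q k) = 1 := by
      rw [hR, partialFractionNumerator.eval_node, hc]
      field_simp
    have h1 := eval_eq_eval_nodal_mul_sum hu.injOn hdeg fun n _ => hqu k n
    have h2 := eval_derivative_eq_eval_nodal_mul hu.injOn hdeg fun n _ => hqu k n
    set T₁ := ∑ n, Lagrange.nodalWeight univ u n * (q k - u n)⁻¹ * (R ^ 2).eval (u n)
    set T₂ := ∑ n, Lagrange.nodalWeight univ u n * (q k - u n)⁻¹ ^ 2 * (R ^ 2).eval (u n)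
    set L := ∑ n, (q k - u n)⁻¹
    have hPk := hw k
    rw [← Lagrange.eval_nodal] at hPk
    rw [Polynomial.eval_pow] at h1
    rw [Polynomial.derivative_sq, Polynomial.eval_mul, Polynomial.eval_mul,
      Polynomial.eval_C] at h2
    set P := (Lagrange.nodal univ u).eval (q k)
    set r := R.eval (q k)
    set r' := (Polynomial.derivative R).eval (q k)
    have hT₁ : T₁ = 1 := by
      linear_combination (-T₁) * hPk - w k ^ 2 * h1 + (w k * r + 1) * hRk
    have hT₂ : T₂ = L - 2 * w k * r' := by
      linear_combination (L * T₁ - T₂) * hPk + w k ^ 2 * h2 - 2 * w k * r' * hRk + L * hT₁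
    have hck : c k * w k = (∏ i ∈ univ.erase k, (q k - q i))⁻¹ := by
      rw [hc]
      field_simp
    rw [hT₁, hT₂, div_eq_mul_inv, ← hck]
    ring
  have hswap : ∑ k, c k * ∑ n, (q k - u n)⁻¹ = -∑ n, ∑ k, c k * (u n - q k)⁻¹ := by
    simp only [mul_sum]
    rw [sum_comm, ← sum_neg_distrib]
    refine sum_congr rfl fun n _ => ?_
    rw [← sum_neg_distrib]
    refine sum_congr rfl fun k _ => ?_
    rw [← neg_sub (u n), inv_neg, mul_neg]
  simp only [hterm]
  rw [sum_comm]
  simp only [← mul_sum, sum_sub_distrib, hres]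
  rw [hswap, partialFractionNumerator.sum_eval_derivative_div q c d hq, ← hd, sum_add_distrib,
    sum_const, card_univ, Fintype.card_fin, nsmul_eq_mul]
  have hNcast : (N : ℂ) = 2 * g + 1 := by exact_mod_cast hN
  rw [hNcast]
  ring

/-- In the setting of the hyperelliptic residue data, `Σ_n (β_n + β_n²)/A12_n = 0`;
equivalently, the `(2,1)`-entries `A21_n = −(β_n + β_n²)/(4·A12_n)` of the residue
matrices sum to zero. -/
theorem sum_A21_eq_zero {g N : ℕ} (hg : 1 ≤ g) (hN : N = 2 * g + 1)
    (u : Fin N → ℂ) (q w a : Fin g → ℂ)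
    (hu : ∀ m n : Fin N, m ≠ n → u m ≠ u n)
    (hq : ∀ i j : Fin g, i ≠ j → q i ≠ q j)
    (hqu : ∀ (j : Fin g) (n : Fin N), q j ≠ u n)
    (hw : ∀ j, (w j) ^ 2 * ∏ m, (q j - u m) = 1)
    (hA : ∀ n, A12res u q w a n ≠ 0) :
    (∑ n, (betaCoef u q w a n + (betaCoef u q w a n) ^ 2) / A12res u q w a n = 0) ∧
      (∑ n, -(betaCoef u q w a n + (betaCoef u q w a n) ^ 2) / (4 * A12res u q w a n)
        = 0) := by
  have hzero : ∑ n, (betaCoef u q w a n + (betaCoef u q w a n) ^ 2) / A12res u q w a n = 0 := by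
    have h := sum_A12res_mul_sq hN u q w a (fun m n => not_imp_not.mp (hu m n))
      (fun i j => not_imp_not.mp (hq i j)) hqu hw _ fun _ => rfl
    rw [← eq_neg_iff_add_eq_zero.mp h, ← sum_add_distrib]
    refine sum_congr rfl fun n _ => ?_
    have hn := hA n
    rw [betaCoef_eq]
    field_simp
    ring
  refine ⟨hzero, ?_⟩
  rw [← mul_zero (-(1 / 4) : ℂ), ← hzero, mul_sum]
  refine sum_congr rfl fun n _ => ?_
  rw [mul_comm 4, ← div_div]
  ring
end
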